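/- Let n ≥ 3 and let {F^{ij} : 1 ≤ i < j ≤ n} be a complete set of fundamental matrices, with F^{ji} := (F^{ij})ᵀ. (a) If there exist nonzero real scalars λ_{ij} = λ_{ji} such that the 3n×3n block matrix 𝐅 with (i,j) block λ_{ij} F^{ij} for i ≠ j and zero 3×3 diagonal blocks has rank 4 and every 3×3n block row of 𝐅 has rank 2, then {F^{ij}} is compatible, with a solution whose camera centers are all collinear. (b) Suppose that in each image no three epipoles lie on a line, i.e., for every index j and pairwise distinct i, k, l ≠ j the vectors e_j^i, e_j^k, e_j^l are linearly independent in ℝ³. If there exist nonzero real scalars λ_{ij} = λ_{ji} such that 𝐅 has rank 6 and every 3×3n block row of 𝐅 has rank 3, then {F^{ij}} is compatible, with a solution whose camera centers are not all collinear. (In other words, the eigenvalue conditions in the known rank-plus-eigenvalue characterization of compatibility are redundant in these two cases.) -/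

import Mathlib

open Matrix

/-- The 6×6 matrix whose first three rows form the block `[P₁ | x | 0]` and whose last
three rows form the block `[P₂ | 0 | y]`. -/
noncomputable def bigMat (P₁ P₂ : Matrix (Fin 3) (Fin 4) ℝ) (x y : Fin 3 → ℝ) :
    Matrix (Fin 6) (Fin 6) ℝ :=
  fun i j =>
    if hi : (i : ℕ) < 3 then
      if hj : (j : ℕ) < 4 then P₁ ⟨(i : ℕ), hi⟩ ⟨(j : ℕ), hj⟩
      else if (j : ℕ) = 4 then x ⟨(i : ℕ), hi⟩ else 0
    else
      if hj : (j : ℕ) < 4 then P₂ ⟨(i : ℕ) - 3, by have := i.isLt; omega⟩ ⟨(j : ℕ), hj⟩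
      else if (j : ℕ) = 4 then 0
      else y ⟨(i : ℕ) - 3, by have := i.isLt; omega⟩

/-- `psi P₁ P₂` is the unique 3×3 matrix `F` such that for all `x y : ℝ³`,
`xᵀ F y = det [P₁ | x | 0; P₂ | 0 | y]`.  (Since the determinant is bilinear in `(x, y)`,
this matrix is obtained by evaluating at pairs of standard basis vectors.) -/
noncomputable def psi (P₁ P₂ : Matrix (Fin 3) (Fin 4) ℝ) : Matrix (Fin 3) (Fin 3) ℝ :=
  fun a b => (bigMat P₁ P₂ (Pi.single a 1) (Pi.single b 1)).det

/-- A camera is a real 3×4 matrix of rank 3. -/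
def IsCamera (P : Matrix (Fin 3) (Fin 4) ℝ) : Prop := P.rank = 3

/-- The `n`-view fundamental matrix: the `3n × 3n` block matrix with `(i,j)` block
`lam i j • F i j` for `i ≠ j` and zero diagonal blocks. -/
def nView (n : ℕ) (F : Fin n → Fin n → Matrix (Fin 3) (Fin 3) ℝ)
    (lam : Fin n → Fin n → ℝ) : Matrix (Fin n × Fin 3) (Fin n × Fin 3) ℝ :=
  fun p q => if p.1 = q.1 then 0 else lam p.1 q.1 * F p.1 q.1 p.2 q.2

/-- The `i`-th `3 × 3n` block row of a `3n × 3n` matrix. -/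
def blockRow (n : ℕ) (M : Matrix (Fin n × Fin 3) (Fin n × Fin 3) ℝ) (i : Fin n) :
    Matrix (Fin 3) (Fin n × Fin 3) ℝ :=
  fun a q => M (i, a) q


def crossMat (h : Fin 3 → ℝ) : Matrix (Fin 3) (Fin 3) ℝ :=
  !![0, -h 2, h 1; h 2, 0, -h 0; -h 1, h 0, 0]

def camOf (A : Matrix (Fin 3) (Fin 3) ℝ) (g : Fin 3 → ℝ) : Matrix (Fin 3) (Fin 4) ℝ :=
  fun a => ![A a 0, A a 1, A a 2, g a]

theorem bigMat_camOf (A A' : Matrix (Fin 3) (Fin 3) ℝ) (g g' x y : Fin 3 → ℝ) :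
    bigMat (camOf A g) (camOf A' g') x y =
      !![A 0 0, A 0 1, A 0 2, g 0, x 0, 0;
         A 1 0, A 1 1, A 1 2, g 1, x 1, 0;
         A 2 0, A 2 1, A 2 2, g 2, x 2, 0;
         A' 0 0, A' 0 1, A' 0 2, g' 0, 0, y 0;
         A' 1 0, A' 1 1, A' 1 2, g' 1, 0, y 1;
         A' 2 0, A' 2 1, A' 2 2, g' 2, 0, y 2] := by
  ext i j
  fin_cases i <;> fin_cases j <;> rfl

theorem det_four (M : Matrix (Fin 4) (Fin 4) ℝ) : M.det =
    M 0 0 * (M 1 1 * (M 2 2 * M 3 3 - M 2 3 * M 3 2) - M 1 2 * (M 2 1 * M 3 3 - M 2 3 * M 3 1)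
      + M 1 3 * (M 2 1 * M 3 2 - M 2 2 * M 3 1))
    - M 0 1 * (M 1 0 * (M 2 2 * M 3 3 - M 2 3 * M 3 2) - M 1 2 * (M 2 0 * M 3 3 - M 2 3 * M 3 0)
      + M 1 3 * (M 2 0 * M 3 2 - M 2 2 * M 3 0))
    + M 0 2 * (M 1 0 * (M 2 1 * M 3 3 - M 2 3 * M 3 1) - M 1 1 * (M 2 0 * M 3 3 - M 2 3 * M 3 0)
      + M 1 3 * (M 2 0 * M 3 1 - M 2 1 * M 3 0))
    - M 0 3 * (M 1 0 * (M 2 1 * M 3 2 - M 2 2 * M 3 1) - M 1 1 * (M 2 0 * M 3 2 - M 2 2 * M 3 0)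
      + M 1 2 * (M 2 0 * M 3 1 - M 2 1 * M 3 0)) := by
  rw [Matrix.det_succ_row_zero]
  simp [Fin.sum_univ_succ, Matrix.det_fin_three, Fin.succAbove]
  ring

theorem det_six (a b c d e f x y : Fin 3 → ℝ) (g h : Fin 3 → ℝ) :
    (!![a 0, b 0, c 0, g 0, x 0, 0;
        a 1, b 1, c 1, g 1, x 1, 0;
        a 2, b 2, c 2, g 2, x 2, 0;
        d 0, e 0, f 0, h 0, 0, y 0;
        d 1, e 1, f 1, h 1, 0, y 1;
        d 2, e 2, f 2, h 2, 0, y 2] : Matrix (Fin 6) (Fin 6) ℝ).det =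
    y 2 * (x 0 * (!![a 1, b 1, c 1, g 1; a 2, b 2, c 2, g 2; d 0, e 0, f 0, h 0; d 1, e 1, f 1, h 1] : Matrix (Fin 4) (Fin 4) ℝ).det
      - x 1 * (!![a 0, b 0, c 0, g 0; a 2, b 2, c 2, g 2; d 0, e 0, f 0, h 0; d 1, e 1, f 1, h 1] : Matrix (Fin 4) (Fin 4) ℝ).det
      + x 2 * (!![a 0, b 0, c 0, g 0; a 1, b 1, c 1, g 1; d 0, e 0, f 0, h 0; d 1, e 1, f 1, h 1] : Matrix (Fin 4) (Fin 4) ℝ).det)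
    - y 1 * (x 0 * (!![a 1, b 1, c 1, g 1; a 2, b 2, c 2, g 2; d 0, e 0, f 0, h 0; d 2, e 2, f 2, h 2] : Matrix (Fin 4) (Fin 4) ℝ).det
      - x 1 * (!![a 0, b 0, c 0, g 0; a 2, b 2, c 2, g 2; d 0, e 0, f 0, h 0; d 2, e 2, f 2, h 2] : Matrix (Fin 4) (Fin 4) ℝ).det
      + x 2 * (!![a 0, b 0, c 0, g 0; a 1, b 1, c 1, g 1; d 0, e 0, f 0, h 0; d 2, e 2, f 2, h 2] : Matrix (Fin 4) (Fin 4) ℝ).det)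
    + y 0 * (x 0 * (!![a 1, b 1, c 1, g 1; a 2, b 2, c 2, g 2; d 1, e 1, f 1, h 1; d 2, e 2, f 2, h 2] : Matrix (Fin 4) (Fin 4) ℝ).det
      - x 1 * (!![a 0, b 0, c 0, g 0; a 2, b 2, c 2, g 2; d 1, e 1, f 1, h 1; d 2, e 2, f 2, h 2] : Matrix (Fin 4) (Fin 4) ℝ).det
      + x 2 * (!![a 0, b 0, c 0, g 0; a 1, b 1, c 1, g 1; d 1, e 1, f 1, h 1; d 2, e 2, f 2, h 2] : Matrix (Fin 4) (Fin 4) ℝ).det) := by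
  rw [Matrix.det_succ_column _ 5]
  simp only [Fin.sum_univ_six]
  rw [Matrix.det_succ_column (Matrix.submatrix _ (Fin.succAbove 3) _) 4,
    Matrix.det_succ_column (Matrix.submatrix _ (Fin.succAbove 4) _) 4,
    Matrix.det_succ_column (Matrix.submatrix _ (Fin.succAbove 5) _) 4]
  simp only [Fin.sum_univ_five, det_four]
  simp [Fin.succAbove]
  ring

theorem psi_camOf (A A' : Matrix (Fin 3) (Fin 3) ℝ) (g g' : Fin 3 → ℝ) :
    psi (camOf A g) (camOf A' g') =
      A.adjugateᵀ * (A'ᵀ * crossMat g') + (Aᵀ * crossMat g)ᵀ * A'.adjugate := by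
  ext a b
  rw [psi, bigMat_camOf, det_six (fun i => A i 0) (fun i => A i 1) (fun i => A i 2)
    (fun i => A' i 0) (fun i => A' i 1) (fun i => A' i 2)]
  simp only [det_four, Matrix.add_apply, Matrix.mul_apply, Fin.sum_univ_three,
      Matrix.transpose_apply, Matrix.adjugate_fin_three]
  fin_cases a <;> fin_cases b <;>
  · simp [crossMat]
    ring

theorem crossMat_mulVec (h v : Fin 3 → ℝ) : crossMat h *ᵥ v =
    ![h 1 * v 2 - h 2 * v 1, h 2 * v 0 - h 0 * v 2, h 0 * v 1 - h 1 * v 0] := by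
  ext a
  fin_cases a <;> simp [crossMat, Matrix.mulVec, dotProduct, Fin.sum_univ_three] <;> ring

theorem crossMat_self (h : Fin 3 → ℝ) : crossMat h *ᵥ h = 0 := by
  rw [crossMat_mulVec]; ext a; fin_cases a <;> simp <;> ring

theorem crossMat_transpose (h : Fin 3 → ℝ) : (crossMat h)ᵀ = - crossMat h := by
  ext a b
  fin_cases a <;> fin_cases b <;> simp [crossMat]

/-- vanishing of the cross product means parallel -/
theorem crossMat_parallel (h v : Fin 3 → ℝ) (hh : h ≠ 0) (H : crossMat h *ᵥ v = 0) :
    ∃ α : ℝ, v = α • h := by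
  rw [crossMat_mulVec] at H
  have h0 := congrFun H 0
  have h1 := congrFun H 1
  have h2 := congrFun H 2
  simp at h0 h1 h2
  have hpos : h 0 ^ 2 + h 1 ^ 2 + h 2 ^ 2 ≠ 0 := by
    intro hz
    apply hh
    ext a
    fin_cases a <;> simp <;> nlinarith [sq_nonneg (h 0), sq_nonneg (h 1), sq_nonneg (h 2)]
  refine ⟨(h 0 * v 0 + h 1 * v 1 + h 2 * v 2) / (h 0 ^ 2 + h 1 ^ 2 + h 2 ^ 2), ?_⟩
  ext a
  fin_cases a <;> simp <;> field_simp
  · linear_combination (-h 1) * h2 + h 2 * h1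
  · linear_combination (-h 2) * h0 + h 0 * h2
  · linear_combination (-h 0) * h1 + h 1 * h0

theorem skew_eq_crossMat (M : Matrix (Fin 3) (Fin 3) ℝ) (hM : M + Mᵀ = 0) :
    ∃ h, M = crossMat h := by
  refine ⟨![M 2 1, M 0 2, M 1 0], ?_⟩
  have H : ∀ a b, M a b + M b a = 0 := fun a b => congrFun (congrFun hM a) b
  ext a b
  have := H 0 0
  have := H 1 1
  have := H 2 2
  have := H 0 1
  have := H 0 2
  have := H 1 2
  fin_cases a <;> fin_cases b <;> simp [crossMat] <;> linarith

theorem crossMat_ne_zero {h : Fin 3 → ℝ} : h ≠ 0 → crossMat h ≠ 0 := by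
  intro hh H
  apply hh
  ext a
  have h0 := congrFun (congrFun H 2) 1
  have h1 := congrFun (congrFun H 0) 2
  have h2 := congrFun (congrFun H 1) 0
  simp [crossMat] at h0 h1 h2
  fin_cases a <;> simp [*]

/-- A matrix with three columns of rank 2 has a one-dimensional kernel. -/
theorem ker_of_rank_two {m : Type*} [Fintype m] (M : Matrix m (Fin 3) ℝ) (hM : M.rank = 2) :
    ∃ u : Fin 3 → ℝ, u ≠ 0 ∧ M *ᵥ u = 0 ∧ ∀ v, M *ᵥ v = 0 → ∃ α : ℝ, v = α • u := by
  have h := LinearMap.finrank_range_add_finrank_ker M.mulVecLin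
  have h1 : Module.finrank ℝ (LinearMap.range M.mulVecLin) = 2 := hM
  rw [h1] at h
  simp at h
  have h2 : Module.finrank ℝ (LinearMap.ker M.mulVecLin) = 1 := by omega
  obtain ⟨⟨u, hu⟩, hu0, H⟩ := finrank_eq_one_iff'.1 h2
  refine ⟨u, ?_, by simpa using hu, ?_⟩
  · intro h; apply hu0; ext1; exact h
  · intro v hv
    obtain ⟨α, hα⟩ := H ⟨v, by simpa using hv⟩
    exact ⟨α, by simpa using (congrArg Subtype.val hα).symm⟩

theorem ker_of_rank_three {m : Type*} [Fintype m] (M : Matrix m (Fin 3) ℝ) (hM : M.rank = 3) :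
    ∀ v, M *ᵥ v = 0 → v = 0 := by
  have h := LinearMap.finrank_range_add_finrank_ker M.mulVecLin
  have h1 : Module.finrank ℝ (LinearMap.range M.mulVecLin) = 3 := hM
  rw [h1] at h
  simp at h
  intro v hv
  have : v ∈ LinearMap.ker M.mulVecLin := by simpa using hv
  rw [h] at this
  simpa using this

/-- Existence of a shear making the first component invertible. -/
theorem exists_shear (p q : Matrix (Fin 3) (Fin 3) ℝ) (hpq : pᵀ * q + qᵀ * p = 0)
    (hinj : ∀ v, p *ᵥ v = 0 → q *ᵥ v = 0 → v = 0) (hq : q = 0 ∨ q.rank = 2) :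
    ∃ b, (p + crossMat b * q).det ≠ 0 := by
  rcases hq with rfl | hq
  · refine ⟨0, fun h => ?_⟩
    obtain ⟨v, hv, H⟩ := Matrix.exists_mulVec_eq_zero_iff.2 h
    exact hv (hinj v (by simpa using H) (by simp))
  obtain ⟨u, hu, hqu, hu'⟩ := ker_of_rank_two q hq
  obtain ⟨a, ha, hqa, ha'⟩ := ker_of_rank_two qᵀ (by rw [rank_transpose]; exact hq)
  have key : ∀ b, qᵀ * (p + crossMat b * q) ≠ 0 → (p + crossMat b * q).det ≠ 0 := by
    intro b hb h
    obtain ⟨v, hv, H⟩ := Matrix.exists_mulVec_eq_zero_iff.2 h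
    obtain ⟨t, ht⟩ := skew_eq_crossMat (qᵀ * (p + crossMat b * q)) (by
      simp only [Matrix.transpose_mul, Matrix.transpose_add, Matrix.transpose_transpose,
        crossMat_transpose]
      rw [← hpq]
      simp only [Matrix.mul_add, Matrix.add_mul, Matrix.mul_neg, Matrix.neg_mul, Matrix.mul_assoc]
      abel)
    have ht0 : t ≠ 0 := by
      rintro rfl
      apply hb; rw [ht]
      ext a b; fin_cases a <;> fin_cases b <;> simp [crossMat]
    have h1 : (p + crossMat b * q) *ᵥ u = p *ᵥ u := by
      rw [Matrix.add_mulVec, ← Matrix.mulVec_mulVec, hqu]; simp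
    have htu : crossMat t *ᵥ u = 0 := by
      rw [← ht, ← Matrix.mulVec_mulVec, h1, Matrix.mulVec_mulVec]
      have : qᵀ * p = - (pᵀ * q) := by rw [eq_neg_iff_add_eq_zero, add_comm]; exact hpq
      rw [this, Matrix.neg_mulVec, ← Matrix.mulVec_mulVec, hqu]; simp
    have htv : crossMat t *ᵥ v = 0 := by
      rw [← ht, ← Matrix.mulVec_mulVec, H]; simp
    obtain ⟨α, hα⟩ := crossMat_parallel t u ht0 htu
    obtain ⟨β, hβ⟩ := crossMat_parallel t v ht0 htv
    have hα0 : α ≠ 0 := by rintro rfl; apply hu; simpa using hα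
    have hβ0 : β ≠ 0 := by rintro rfl; apply hv; simpa using hβ
    have hpt : (p + crossMat b * q) *ᵥ t = 0 := by
      rw [hβ, Matrix.mulVec_smul] at H
      exact (smul_eq_zero.1 H).resolve_left hβ0
    apply hu
    apply hinj u _ hqu
    rw [← h1, hα, Matrix.mulVec_smul, hpt, smul_zero]
  by_cases h0 : qᵀ * p = 0
  · refine ⟨a, key a ?_⟩
    rw [Matrix.mul_add, h0, zero_add]
    intro hz
    have hq0 : q ≠ 0 := by rintro rfl; simp at hq
    apply hq0
    have hv : ∀ v, q *ᵥ v = 0 := by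
      intro v
      have h1 : qᵀ *ᵥ (crossMat a *ᵥ (q *ᵥ v)) = 0 := by
        rw [Matrix.mulVec_mulVec, Matrix.mulVec_mulVec, Matrix.mul_assoc, hz]; simp
      obtain ⟨α, hα⟩ := ha' _ h1
      have h3 : a ⬝ᵥ (q *ᵥ v) = 0 := by
        rw [Matrix.dotProduct_mulVec, ← Matrix.mulVec_transpose, hqa]; simp
      generalize q *ᵥ v = w at *
      have hpos : a 0 ^ 2 + a 1 ^ 2 + a 2 ^ 2 ≠ 0 := by
        intro hz
        apply ha
        ext i
        fin_cases i <;> simp <;> nlinarith [sq_nonneg (a 0), sq_nonneg (a 1), sq_nonneg (a 2)]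
      have hα0 : α = 0 := by
        rw [crossMat_mulVec] at hα
        have h0 := congrFun hα 0
        have h1 := congrFun hα 1
        have h2 := congrFun hα 2
        simp at h0 h1 h2
        have : α * (a 0 ^ 2 + a 1 ^ 2 + a 2 ^ 2) = 0 := by
          linear_combination -a 0 * h0 - a 1 * h1 - a 2 * h2
        exact (mul_eq_zero.1 this).resolve_right hpos
      rw [hα0, zero_smul] at hα
      obtain ⟨β, rfl⟩ := crossMat_parallel a w ha hα
      have : β = 0 := by
        simp [dotProduct, Fin.sum_univ_three] at h3
        have : β * (a 0 ^ 2 + a 1 ^ 2 + a 2 ^ 2) = 0 := by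
          linear_combination h3
        exact (mul_eq_zero.1 this).resolve_right hpos
      simp [this]
    ext i j
    have := congrFun (hv (Pi.single j 1)) i
    simpa using this
  · refine ⟨0, key 0 ?_⟩
    have : crossMat 0 = 0 := by
      ext a b; fin_cases a <;> fin_cases b <;> simp [crossMat]
    simpa [this] using h0

theorem adj_shear (p : Matrix (Fin 3) (Fin 3) ℝ) (b h : Fin 3 → ℝ) :
    (p.adjugate + vecMulVec h b).adjugate = p.det • p - crossMat b * (p.adjugateᵀ * crossMat h) := by
  ext i j
  fin_cases i <;> fin_cases j <;>
  · simp only [Matrix.sub_apply, Matrix.smul_apply, Matrix.mul_apply, Fin.sum_univ_three,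
      Matrix.transpose_apply, Matrix.adjugate_fin_three]
    simp [crossMat, Matrix.det_fin_three, vecMulVec_apply]
    ring

theorem camera_of (p q : Matrix (Fin 3) (Fin 3) ℝ) (hpq : pᵀ * q + qᵀ * p = 0)
    (hinj : ∀ v, p *ᵥ v = 0 → q *ᵥ v = 0 → v = 0) (hq : q = 0 ∨ q.rank = 2) :
    ∃ (A : Matrix (Fin 3) (Fin 3) ℝ) (g : Fin 3 → ℝ) (s : ℝ) (x : Fin 3 → ℝ) (y : ℝ),
      s ≠ 0 ∧ A.adjugate = s • p ∧ Aᵀ * crossMat g = s • q ∧ IsCamera (camOf A g) ∧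
      camOf A g *ᵥ ![x 0, x 1, x 2, y] = 0 ∧ (x = 0 → y ≠ 0) ∧
      (q = 0 → x = 0) ∧ (q ≠ 0 → x ≠ 0) ∧ qᵀ *ᵥ x = 0 ∧
      (∀ v, v ≠ 0 → q *ᵥ v = 0 → ∃ α : ℝ, x = α • (p *ᵥ v)) := by
  obtain ⟨b, hb⟩ := exists_shear p q hpq hinj hq
  set P := p + crossMat b * q with hP
  obtain ⟨h, hh⟩ := skew_eq_crossMat (Pᵀ * q) (by
      rw [hP]
      simp only [Matrix.transpose_mul, Matrix.transpose_add, Matrix.transpose_transpose,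
        crossMat_transpose, Matrix.transpose_neg]
      rw [← hpq]
      simp only [Matrix.mul_add, Matrix.add_mul, Matrix.mul_neg, Matrix.neg_mul, Matrix.mul_assoc]
      abel)
  have hq' : P.adjugateᵀ * crossMat h = P.det • q := by
    rw [← hh, ← Matrix.mul_assoc, ← Matrix.transpose_mul, Matrix.mul_adjugate]; simp
  have hbh : vecMulVec b h * crossMat h = 0 := by
    rw [Matrix.vecMulVec_mul, ← Matrix.mulVec_transpose, crossMat_transpose, Matrix.neg_mulVec, crossMat_self]
    simp
  have hPinj : ∀ v, P *ᵥ v = 0 → v = 0 := fun v hv => by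
    by_contra hne
    exact hb (Matrix.exists_mulVec_eq_zero_iff.1 ⟨v, hne, hv⟩)
  have hq0 : q = 0 ↔ h = 0 := by
    constructor
    · intro h0
      by_contra hne
      apply crossMat_ne_zero hne
      rw [← hh, h0]; simp
    · intro h0
      have : crossMat h = 0 := by
        rw [h0]; ext a b; fin_cases a <;> fin_cases b <;> simp [crossMat]
      rw [this] at hq'
      simpa [hb] using hq'.symm
  have hmv : ∀ (A : Matrix (Fin 3) (Fin 3) ℝ) (g x : Fin 3 → ℝ) (y : ℝ),
      camOf A g *ᵥ ![x 0, x 1, x 2, y] = A *ᵥ x + y • g := by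
    intro A g x y
    ext i
    simp [camOf, Matrix.mulVec, dotProduct, Fin.sum_univ_succ]
    ring
  have hPh : P.adjugate *ᵥ (P *ᵥ h) = P.det • h := by
    rw [Matrix.mulVec_mulVec, Matrix.adjugate_mul, Matrix.smul_mulVec, Matrix.one_mulVec]
  refine ⟨P.adjugate + vecMulVec h b, h, P.det, P *ᵥ h, -P.det - b ⬝ᵥ (P *ᵥ h), hb, ?_, ?_, ?_,
    ?_, ?_, ?_, ?_, ?_, ?_⟩
  · rw [adj_shear, hq', hP, Matrix.mul_smul]; rw [← smul_sub]; simp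
  · rw [Matrix.transpose_add, Matrix.add_mul, hq', Matrix.transpose_vecMulVec, hbh, add_zero]
  · -- rank 3
    unfold IsCamera
    rw [← rank_transpose]
    have hli : ∀ v, (camOf (P.adjugate + vecMulVec h b) h)ᵀ *ᵥ v = 0 → v = 0 := by
      intro v hv
      have h3 : h ⬝ᵥ v = 0 := by
        have := congrFun hv 3
        simpa [camOf, Matrix.mulVec, dotProduct, Fin.sum_univ_succ] using this
      have h4 : (P.adjugate + vecMulVec h b)ᵀ *ᵥ v = 0 := by
        ext i
        fin_cases i
        · simpa [camOf, Matrix.mulVec, dotProduct, Fin.sum_univ_succ] using congrFun hv 0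
        · simpa [camOf, Matrix.mulVec, dotProduct, Fin.sum_univ_succ] using congrFun hv 1
        · simpa [camOf, Matrix.mulVec, dotProduct, Fin.sum_univ_succ] using congrFun hv 2
      rw [Matrix.transpose_add, Matrix.add_mulVec, Matrix.transpose_vecMulVec,
        Matrix.vecMulVec_mulVec, h3] at h4
      have h5 : P.adjugateᵀ *ᵥ v = 0 := by simpa using h4
      have h6 : Pᵀ *ᵥ (P.adjugateᵀ *ᵥ v) = P.det • v := by
        rw [Matrix.mulVec_mulVec, ← Matrix.transpose_mul, Matrix.adjugate_mul,
          Matrix.transpose_smul, Matrix.transpose_one, Matrix.smul_mulVec, Matrix.one_mulVec]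
      rw [h5] at h6
      simpa [hb] using h6.symm
    have hf := LinearMap.finrank_range_add_finrank_ker
      ((camOf (P.adjugate + vecMulVec h b) h)ᵀ).mulVecLin
    have hk : LinearMap.ker ((camOf (P.adjugate + vecMulVec h b) h)ᵀ).mulVecLin = ⊥ := by
      rw [LinearMap.ker_eq_bot']
      intro m hm
      exact hli m hm
    rw [hk] at hf
    simp at hf
    exact hf
  · rw [hmv, Matrix.add_mulVec, hPh, Matrix.vecMulVec_mulVec]
    ext i; simp; ring
  · intro h0
    rw [h0]; simpa using hb
  · intro h0
    rw [hq0.1 h0]; simp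
  · intro h0 h1
    exact h0 (hq0.2 (hPinj _ h1))
  · have : qᵀ * P = (Pᵀ * q)ᵀ := by simp
    rw [Matrix.mulVec_mulVec, this, hh, crossMat_transpose, Matrix.neg_mulVec, crossMat_self, neg_zero]
  · intro v hv hqv
    have h1 : crossMat h *ᵥ v = 0 := by rw [← hh, ← Matrix.mulVec_mulVec, hqv]; simp
    have h2 : crossMat v *ᵥ h = 0 := by
      rw [crossMat_mulVec] at h1 ⊢
      have e0 := congrFun h1 0
      have e1 := congrFun h1 1
      have e2 := congrFun h1 2
      simp at e0 e1 e2
      ext i; fin_cases i <;> simp <;> linarith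
    obtain ⟨α, hα⟩ := crossMat_parallel v h hv h2
    refine ⟨α, ?_⟩
    rw [hα, Matrix.mulVec_smul, hP, Matrix.add_mulVec, ← Matrix.mulVec_mulVec, hqv]; simp

theorem dot_self_zero {m : Type*} [Fintype m] {v : m → ℝ} (h : v ⬝ᵥ v = 0) : v = 0 :=
  dotProduct_self_eq_zero.1 h

theorem hyperbolic {N : Type*} [Fintype N] [DecidableEq N] (G : Matrix N N ℝ) (hG : Gᵀ = G)
    (E : Matrix N (Fin 3) ℝ) (R : Matrix (Fin 3) N ℝ) (hR : Eᵀ * G = R)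
    (Q : Matrix (Fin 3) (Fin 3) ℝ) (hQt : Qᵀ = Q) (hQQ : Q * Q = Q)
    (hRE : R * E = 0) (hQR : Q * R = 0) (hker : ∀ y, Rᵀ *ᵥ y = 0 → Q *ᵥ y = y)
    (hr : G.rank = 2 * R.rank) :
    ∃ Y : Matrix (Fin 3) N ℝ, Q * Y = 0 ∧ G = Yᵀ * R + Rᵀ * Y := by
  have hGE : G * E = Rᵀ := by rw [← hR, Matrix.transpose_mul, hG, Matrix.transpose_transpose]
  have hRQ : Rᵀ * Q = 0 := by
    have := congrArg Matrix.transpose hQR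
    rwa [Matrix.transpose_mul, hQt, Matrix.transpose_zero] at this
  set S := R * Rᵀ + Q with hS
  have hSdet : IsUnit S.det := by
    rw [isUnit_iff_ne_zero]
    intro h
    obtain ⟨v, hv, H⟩ := Matrix.exists_mulVec_eq_zero_iff.2 h
    have h1 : v ⬝ᵥ (S *ᵥ v) = (Rᵀ *ᵥ v) ⬝ᵥ (Rᵀ *ᵥ v) + (Q *ᵥ v) ⬝ᵥ (Q *ᵥ v) := by
      rw [hS, Matrix.add_mulVec, dotProduct_add]
      congr 1
      · rw [← Matrix.mulVec_mulVec, Matrix.dotProduct_mulVec, ← Matrix.mulVec_transpose]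
      · conv_lhs => rw [← hQQ, ← Matrix.mulVec_mulVec, Matrix.dotProduct_mulVec,
          ← Matrix.mulVec_transpose, hQt]
    rw [H, dotProduct_zero] at h1
    have h2 : 0 ≤ (Rᵀ *ᵥ v) ⬝ᵥ (Rᵀ *ᵥ v) := by
      simpa using dotProduct_star_self_nonneg (Rᵀ *ᵥ v)
    have h3 : 0 ≤ (Q *ᵥ v) ⬝ᵥ (Q *ᵥ v) := by
      simpa using dotProduct_star_self_nonneg (Q *ᵥ v)
    have h4 := dot_self_zero (show (Rᵀ *ᵥ v) ⬝ᵥ (Rᵀ *ᵥ v) = 0 by linarith)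
    have h5 := dot_self_zero (show (Q *ᵥ v) ⬝ᵥ (Q *ᵥ v) = 0 by linarith)
    exact hv (by rw [← hker v h4, h5])
  have hQS : Q * S = Q := by rw [hS, Matrix.mul_add, ← Matrix.mul_assoc, hQR, hQQ]; simp
  have hQS' : Q * S⁻¹ = Q := by
    conv_lhs => rw [← hQS]
    rw [Matrix.mul_assoc, Matrix.mul_nonsing_inv _ hSdet, Matrix.mul_one]
  have hQP : Q * (1 - Q) = 0 := by rw [Matrix.mul_sub, hQQ]; simp
  have hPQ : (1 - Q) * Q = 0 := by rw [Matrix.sub_mul, hQQ]; simp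
  have hPP : (1 - Q) * (1 - Q) = 1 - Q := by rw [Matrix.sub_mul, hQP]; simp
  have hPt : (1 - Q)ᵀ = 1 - Q := by rw [Matrix.transpose_sub, hQt]; simp
  set X0 := Rᵀ * S⁻¹ * (1 - Q) with hX0
  have hRX0 : R * X0 = 1 - Q := by
    have : R * Rᵀ = S - Q := by rw [hS]; simp
    rw [hX0, ← Matrix.mul_assoc, ← Matrix.mul_assoc, this, Matrix.sub_mul,
      Matrix.mul_nonsing_inv _ hSdet, hQS', hPP]
  have hX0P : X0 * (1 - Q) = X0 := by rw [hX0, Matrix.mul_assoc, hPP]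
  set T := X0ᵀ * G * X0 with hT
  have hTt : Tᵀ = T := by
    rw [hT]; simp only [Matrix.transpose_mul, Matrix.transpose_transpose, hG, Matrix.mul_assoc]
  have hTP : T * (1 - Q) = T := by rw [hT, Matrix.mul_assoc, hX0P]
  have hPT : (1 - Q) * T = T := by
    have := congrArg Matrix.transpose hTP
    rwa [Matrix.transpose_mul, hTt, hPt] at this
  set X := X0 - (1 / 2 : ℝ) • (E * T) with hX
  have hRX : R * X = 1 - Q := by
    rw [hX, Matrix.mul_sub, hRX0, Matrix.mul_smul, ← Matrix.mul_assoc, hRE]; simp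
  have hXP : X * (1 - Q) = X := by
    rw [hX, Matrix.sub_mul, hX0P, Matrix.smul_mul, Matrix.mul_assoc, hTP]
  have hXQ : X * Q = 0 := by
    rw [← hXP, Matrix.mul_assoc, hPQ, Matrix.mul_zero]
  set Y := Xᵀ * G with hY
  have hYE : Y * E = 1 - Q := by
    rw [hY, Matrix.mul_assoc, hGE, ← Matrix.transpose_mul, hRX, hPt]
  have hYX0 : Y * X0 = (1 / 2 : ℝ) • T := by
    have : Tᵀ * (Eᵀ * G) * X0 = T := by
      rw [hR, Matrix.mul_assoc, hRX0, hTt, hTP]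
    rw [hY, hX, Matrix.transpose_sub, Matrix.transpose_smul, Matrix.transpose_mul E T,
      Matrix.sub_mul, Matrix.sub_mul, ← hT, Matrix.smul_mul, Matrix.smul_mul,
      Matrix.mul_assoc Tᵀ, this]
    module
  have hYX : Y * X = 0 := by
    rw [hX, Matrix.mul_sub, hYX0, Matrix.mul_smul, ← Matrix.mul_assoc, hYE, hPT, sub_self]
  have hQY : Q * Y = 0 := by
    have := congrArg Matrix.transpose hXQ
    rw [Matrix.transpose_mul, hQt, Matrix.transpose_zero] at this
    rw [hY, ← Matrix.mul_assoc, this, Matrix.zero_mul]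
  have hPR : (1 - Q) * R = R := by rw [Matrix.sub_mul, hQR]; simp
  have hPY : (1 - Q) * Y = Y := by rw [Matrix.sub_mul, hQY]; simp
  -- kernels
  let Z : (N → ℝ) →ₗ[ℝ] (Fin 3 → ℝ) × (Fin 3 → ℝ) := R.mulVecLin.prod Y.mulVecLin
  have hle : LinearMap.ker G.mulVecLin ≤ LinearMap.ker Z := by
    intro v hv
    have hv' : G *ᵥ v = 0 := hv
    have h1 : R *ᵥ v = 0 := by rw [← hR, ← Matrix.mulVec_mulVec, hv', Matrix.mulVec_zero]
    have h2 : Y *ᵥ v = 0 := by rw [hY, ← Matrix.mulVec_mulVec, hv', Matrix.mulVec_zero]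
    simp [Z, LinearMap.mem_ker, h1, h2]
  have hrP : R.rank ≤ (1 - Q).rank := by
    conv_lhs => rw [← hPR]
    exact Matrix.rank_mul_le_left _ _
  let W := LinearMap.range (1 - Q).mulVecLin
  have hZr : 2 * R.rank ≤ Module.finrank ℝ (LinearMap.range Z) := by
    let f : (W × W) →ₗ[ℝ] (Fin 3 → ℝ) × (Fin 3 → ℝ) := W.subtype.prodMap W.subtype
    have hf : ∀ w, f w ∈ LinearMap.range Z := by
      rintro ⟨⟨_, a, rfl⟩, ⟨_, b, rfl⟩⟩
      refine ⟨X *ᵥ a + E *ᵥ b, ?_⟩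
      show (R *ᵥ (X *ᵥ a + E *ᵥ b), Y *ᵥ (X *ᵥ a + E *ᵥ b)) = ((1 - Q) *ᵥ a, (1 - Q) *ᵥ b)
      simp only [Matrix.mulVec_add,
        Matrix.mulVec_mulVec, hRX, hRE, hYX, hYE, Matrix.zero_mulVec, add_zero, zero_add]
    have hinj : Function.Injective (f.codRestrict _ hf) := by
      intro u v huv
      have h1 : f u = f v := congrArg Subtype.val huv
      have h2 := congrArg Prod.fst h1
      have h3 := congrArg Prod.snd h1
      exact Prod.ext (Subtype.ext h2) (Subtype.ext h3)
    have := LinearMap.finrank_le_finrank_of_injective hinj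
    rw [Module.finrank_prod] at this
    have hW : Module.finrank ℝ W = (1 - Q).rank := rfl
    omega
  have hkereq : LinearMap.ker G.mulVecLin = LinearMap.ker Z := by
    apply Submodule.eq_of_le_of_finrank_le hle
    have h1 := LinearMap.finrank_range_add_finrank_ker G.mulVecLin
    have h2 := LinearMap.finrank_range_add_finrank_ker Z
    have h3 : Module.finrank ℝ (LinearMap.range G.mulVecLin) = G.rank := rfl
    omega
  refine ⟨Y, hQY, ?_⟩
  have hYt : Yᵀ = G * X := by rw [hY, Matrix.transpose_mul, hG, Matrix.transpose_transpose]
  have key : ∀ v, G *ᵥ v = (Yᵀ * R + Rᵀ * Y) *ᵥ v := by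
    intro v
    have hz : v - X *ᵥ (R *ᵥ v) - E *ᵥ (Y *ᵥ v) ∈ LinearMap.ker G.mulVecLin := by
      rw [hkereq, LinearMap.mem_ker]
      show (R *ᵥ (v - X *ᵥ (R *ᵥ v) - E *ᵥ (Y *ᵥ v)), Y *ᵥ (v - X *ᵥ (R *ᵥ v) - E *ᵥ (Y *ᵥ v))) = 0
      simp only [Matrix.mulVec_sub,
        Matrix.mulVec_mulVec, ← Matrix.mul_assoc, hRX, hRE, hYX, hYE, hPR, hPY]
      simp
    have hz' : G *ᵥ (v - X *ᵥ (R *ᵥ v) - E *ᵥ (Y *ᵥ v)) = 0 := hz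
    rw [Matrix.mulVec_sub, Matrix.mulVec_sub] at hz'
    simp only [Matrix.mulVec_mulVec, ← Matrix.mul_assoc, hGE, ← hYt] at hz'
    rw [Matrix.add_mulVec, ← sub_eq_zero, ← hz']
    abel
  ext i j
  have := congrFun (key (Pi.single j 1)) i
  simpa using this

theorem core (n : ℕ) (i0 : Fin n) (p q : Fin n → Matrix (Fin 3) (Fin 3) ℝ) (hq0 : q i0 = 0)
    (hskew : ∀ i, (p i)ᵀ * q i + (q i)ᵀ * p i = 0)
    (hinj : ∀ i v, p i *ᵥ v = 0 → q i *ᵥ v = 0 → v = 0)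
    (F : Fin n → Fin n → Matrix (Fin 3) (Fin 3) ℝ) (lam : Fin n → Fin n → ℝ)
    (hlam : ∀ i j, i ≠ j → lam i j ≠ 0)
    (hF : ∀ i j, i ≠ j → (p i)ᵀ * q j + (q i)ᵀ * p j = lam i j • F i j)
    (hrank : ∀ i j, i ≠ j → (F i j).rank = 2) :
    ∃ (P : Fin n → Matrix (Fin 3) (Fin 4) ℝ) (mu : Fin n → Fin n → ℝ) (x : Fin n → Fin 3 → ℝ)
      (y : Fin n → ℝ), (∀ i, IsCamera (P i)) ∧
      (∀ i j, i < j → mu i j ≠ 0 ∧ mu i j • F i j = psi (P i) (P j)) ∧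
      (∀ i, P i *ᵥ ![x i 0, x i 1, x i 2, y i] = 0) ∧ (∀ i, x i = 0 → y i ≠ 0) ∧
      x i0 = 0 ∧ (∀ i, i ≠ i0 → x i ≠ 0) ∧ (∀ i, (q i)ᵀ *ᵥ x i = 0) ∧
      (∀ i v, v ≠ 0 → q i *ᵥ v = 0 → ∃ α : ℝ, x i = α • (p i *ᵥ v)) := by
  have hq : ∀ i, i ≠ i0 → (q i).rank = 2 := by
    intro i hi
    have h1 := hF i0 i hi.symm
    rw [hq0, Matrix.transpose_zero, Matrix.zero_mul, add_zero] at h1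
    have hdet : (p i0)ᵀ.det ≠ 0 := by
      rw [Matrix.det_transpose]
      intro h
      obtain ⟨v, hv, H⟩ := Matrix.exists_mulVec_eq_zero_iff.2 h
      exact hv (hinj i0 v H (by rw [hq0]; simp))
    have h2 : ((p i0)ᵀ * q i).rank = 2 := by
      rw [h1, Matrix.rank_smul_of_mem_nonZeroDivisors _
        (mem_nonZeroDivisors_of_ne_zero (hlam i0 i hi.symm)), hrank i0 i hi.symm]
    rwa [Matrix.rank_mul_eq_right_of_det_ne_zero _ _ hdet] at h2
  have hq' : ∀ i, q i = 0 ∨ (q i).rank = 2 := by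
    intro i
    by_cases h : i = i0
    · left; rw [h, hq0]
    · right; exact hq i h
  choose A g s x y hs hA hg hcam hc hy hx0 hx1 hqx hv using
    fun i => camera_of (p i) (q i) (hskew i) (hinj i) (hq' i)
  refine ⟨fun i => camOf (A i) (g i), fun i j => s i * s j * lam i j, x, y, hcam, ?_, hc, hy,
    hx0 i0 hq0, ?_, hqx, hv⟩
  · intro i j hij
    have hne := ne_of_lt hij
    refine ⟨mul_ne_zero (mul_ne_zero (hs i) (hs j)) (hlam i j hne), ?_⟩
    rw [psi_camOf, hA, hA, hg, hg, mul_smul, ← hF i j hne]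
    simp only [Matrix.transpose_smul, Matrix.smul_mul, Matrix.mul_smul, smul_add, mul_smul]
    rw [smul_comm (s j) (s i), smul_comm (s j) (s i)]
  · intro i hi
    apply hx1
    intro h
    have := hq i hi
    rw [h] at this
    simp at this

theorem nView_transpose (n : ℕ) (F : Fin n → Fin n → Matrix (Fin 3) (Fin 3) ℝ)
    (hsym : ∀ i j, F j i = (F i j)ᵀ) (lam : Fin n → Fin n → ℝ) (hl : ∀ i j, lam i j = lam j i) :
    (nView n F lam)ᵀ = nView n F lam := by
  ext ⟨i, a⟩ ⟨j, b⟩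
  simp only [Matrix.transpose_apply, nView]
  by_cases h : i = j
  · simp [h]
  · have h' : j ≠ i := fun e => h e.symm
    simp [h, h', hl i j, hsym j i]

theorem setup (n : ℕ) (i0 : Fin n) (F : Fin n → Fin n → Matrix (Fin 3) (Fin 3) ℝ)
    (hsym : ∀ i j, F j i = (F i j)ᵀ) (lam : Fin n → Fin n → ℝ) (hl : ∀ i j, lam i j = lam j i)
    (Q : Matrix (Fin 3) (Fin 3) ℝ) (hQt : Qᵀ = Q) (hQQ : Q * Q = Q)
    (hQR : Q * blockRow n (nView n F lam) i0 = 0)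
    (hker : ∀ y, (blockRow n (nView n F lam) i0)ᵀ *ᵥ y = 0 → Q *ᵥ y = y)
    (hr : (nView n F lam).rank = 2 * (blockRow n (nView n F lam) i0).rank) :
    ∃ Y q : Fin n → Matrix (Fin 3) (Fin 3) ℝ, (∀ i, Q * Y i = 0) ∧ q i0 = 0 ∧
      (∀ i a b, q i a b = blockRow n (nView n F lam) i0 a (i, b)) ∧
      (∀ i, (Y i)ᵀ * q i + (q i)ᵀ * Y i = 0) ∧
      (∀ i j, i ≠ j → (Y i)ᵀ * q j + (q i)ᵀ * Y j = lam i j • F i j) ∧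
      (∀ i v, Y i *ᵥ v = 0 → q i *ᵥ v = 0 → (blockRow n (nView n F lam) i)ᵀ *ᵥ v = 0) := by
  set G := nView n F lam with hGdef
  set R := blockRow n G i0 with hRdef
  have hG : Gᵀ = G := nView_transpose n F hsym lam hl
  let E : Matrix (Fin n × Fin 3) (Fin 3) ℝ := Matrix.of fun p a => if p = (i0, a) then 1 else 0
  obtain ⟨Y, hQY, hY⟩ := hyperbolic G hG E R (by
      ext a q
      rw [Matrix.mul_apply]
      simp [E, hRdef, blockRow]) Q hQt hQQ (by
      ext a b
      rw [Matrix.mul_apply]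
      simp [E, hRdef, blockRow, hGdef, nView]) hQR hker hr
  let Yb : Fin n → Matrix (Fin 3) (Fin 3) ℝ := fun i => Matrix.of fun c d => Y c (i, d)
  let Rb : Fin n → Matrix (Fin 3) (Fin 3) ℝ := fun i => Matrix.of fun c d => R c (i, d)
  have hblk : ∀ i j a b, G (i, a) (j, b) = ((Yb i)ᵀ * Rb j + (Rb i)ᵀ * Yb j) a b := by
    intro i j a b
    have := congrFun (congrFun hY (i, a)) (j, b)
    exact this
  refine ⟨Yb, Rb, ?_, ?_, ?_, ?_, ?_, ?_⟩
  · intro i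
    ext a b
    exact congrFun (congrFun hQY a) (i, b)
  · ext a b
    simp [Rb, hRdef, blockRow, hGdef, nView]
  · intros; rfl
  · intro i
    ext a b
    rw [← hblk]
    simp [hGdef, nView]
  · intro i j hij
    ext a b
    rw [← hblk]
    simp [hGdef, nView, hij]
  · intro i v h1 h2
    have h3 : ∀ j, (Matrix.of fun c d => G (i, d) (j, c) : Matrix (Fin 3) (Fin 3) ℝ) *ᵥ v = 0 := by
      intro j
      have : (Matrix.of fun c d => G (i, d) (j, c) : Matrix (Fin 3) (Fin 3) ℝ) =
          (Yb j)ᵀ * Rb i + (Rb j)ᵀ * Yb i := by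
        ext c d
        rw [← hblk]
        exact congrFun (congrFun hG (j, c)) (i, d)
      rw [this, Matrix.add_mulVec, ← Matrix.mulVec_mulVec, ← Matrix.mulVec_mulVec, h1, h2]
      simp
    ext ⟨j, b⟩
    exact congrFun (h3 j) b

theorem vecMulVec_zero_right {m k : Type*} (u : m → ℝ) : vecMulVec u (0 : k → ℝ) = 0 := by
  ext; simp [vecMulVec_apply]

theorem vecMulVec_zero_left {m k : Type*} (u : k → ℝ) : vecMulVec (0 : m → ℝ) u = 0 := by
  ext; simp [vecMulVec_apply]

/-- the eigenvalue conditions in the rank characterization of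
compatibility are redundant, (a) in the collinear case, (b) in the case where in each
image no three epipoles lie on a line.  Here `e i j` denotes the epipole `e_j^i`. -/
theorem stmt18 (n : ℕ) (hn : 3 ≤ n)
    (F : Fin n → Fin n → Matrix (Fin 3) (Fin 3) ℝ)
    (hsym : ∀ i j, F j i = (F i j)ᵀ)
    (hrank : ∀ i j, i ≠ j → (F i j).rank = 2)
    (e : Fin n → Fin n → (Fin 3 → ℝ))
    (he : ∀ i j, i ≠ j → e i j ≠ 0 ∧ F i j *ᵥ e i j = 0) :
    -- (a) the collinear case
    ((∃ lam : Fin n → Fin n → ℝ,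
        (∀ i j, lam i j = lam j i) ∧ (∀ i j, i ≠ j → lam i j ≠ 0) ∧
        (nView n F lam).rank = 4 ∧
        (∀ i, (blockRow n (nView n F lam) i).rank = 2)) →
      ∃ (P : Fin n → Matrix (Fin 3) (Fin 4) ℝ) (mu : Fin n → Fin n → ℝ),
        (∀ i, IsCamera (P i)) ∧
        (∀ i j, i < j → mu i j ≠ 0 ∧ mu i j • F i j = psi (P i) (P j)) ∧
        ∃ c : Fin n → (Fin 4 → ℝ),
          (∀ i, c i ≠ 0 ∧ P i *ᵥ c i = 0) ∧
          Module.finrank ℝ (Submodule.span ℝ (Set.range c)) ≤ 2) ∧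
    -- (b) the case of no three collinear epipoles in any image
    ((∀ j i k l : Fin n, i ≠ j → k ≠ j → l ≠ j → i ≠ k → i ≠ l → k ≠ l →
        LinearIndependent ℝ ![e i j, e k j, e l j]) →
      (∃ lam : Fin n → Fin n → ℝ,
        (∀ i j, lam i j = lam j i) ∧ (∀ i j, i ≠ j → lam i j ≠ 0) ∧
        (nView n F lam).rank = 6 ∧
        (∀ i, (blockRow n (nView n F lam) i).rank = 3)) →
      ∃ (P : Fin n → Matrix (Fin 3) (Fin 4) ℝ) (mu : Fin n → Fin n → ℝ),
        (∀ i, IsCamera (P i)) ∧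
        (∀ i j, i < j → mu i j ≠ 0 ∧ mu i j • F i j = psi (P i) (P j)) ∧
        ∃ c : Fin n → (Fin 4 → ℝ),
          (∀ i, c i ≠ 0 ∧ P i *ᵥ c i = 0) ∧
          2 < Module.finrank ℝ (Submodule.span ℝ (Set.range c))) := by

  have hi : 0 < n := by omega
  set i0 : Fin n := ⟨0, hi⟩ with hi0
  constructor
  · rintro ⟨lam, hl, hl0, hG4, hrow⟩
    obtain ⟨u, hu, hRu, hu'⟩ := ker_of_rank_two (blockRow n (nView n F lam) i0)ᵀ
      (by rw [rank_transpose]; exact hrow i0)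
    have huu : u ⬝ᵥ u ≠ 0 := fun h => hu (dot_self_zero h)
    set Q : Matrix (Fin 3) (Fin 3) ℝ := (u ⬝ᵥ u)⁻¹ • vecMulVec u u with hQ
    have hQu : Q *ᵥ u = u := by
      rw [hQ, Matrix.smul_mulVec, Matrix.vecMulVec_mulVec]
      ext i; simp; field_simp
    obtain ⟨Y, q, hQY, hq0, hqR, hskew, hF, hinj⟩ := setup n i0 F hsym lam hl Q
      (by rw [hQ, Matrix.transpose_smul, Matrix.transpose_vecMulVec])
      (by
        nth_rewrite 2 [hQ]
        rw [Matrix.mul_smul, Matrix.mul_vecMulVec, hQu])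
      (by
        rw [hQ, Matrix.smul_mul, Matrix.vecMulVec_mul, ← Matrix.mulVec_transpose, hRu, vecMulVec_zero_right, smul_zero])
      (by
        intro y hy
        obtain ⟨α, rfl⟩ := hu' y hy
        rw [Matrix.mulVec_smul, hQu])
      (by rw [hG4, hrow])
    have huq : ∀ i, u ᵥ* q i = 0 := by
      intro i
      ext b
      have := congrFun hRu (i, b)
      simp only [Matrix.mulVec, Matrix.transpose_apply, dotProduct] at this
      simp only [Matrix.vecMul, dotProduct, hqR]
      refine Eq.trans ?_ this
      exact Finset.sum_congr rfl fun _ _ => mul_comm _ _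
    choose κ hκ hκ0 hκ' using fun i => ker_of_rank_two (blockRow n (nView n F lam) i)ᵀ
      (by rw [rank_transpose]; exact hrow i)
    have hqκ : ∀ i, q i *ᵥ κ i = 0 := by
      intro i
      ext a
      have := congrFun (hκ0 i) (i0, a)
      simp only [Matrix.mulVec, Matrix.transpose_apply, dotProduct] at this ⊢
      refine Eq.trans ?_ this
      refine Finset.sum_congr rfl fun b _ => ?_
      rw [hqR]
      congr 1
      exact congrFun (congrFun (nView_transpose n F hsym lam hl) (i, b)) (i0, a)
    have hYκ : ∀ i, Y i *ᵥ κ i = 0 := by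
      intro i
      have h1 : (blockRow n (nView n F lam) i0)ᵀ *ᵥ (Y i *ᵥ κ i) = 0 := by
        have h2 : ∀ j, (q j)ᵀ *ᵥ (Y i *ᵥ κ i) = 0 := by
          intro j
          have h3 : ((Y j)ᵀ * q i + (q j)ᵀ * Y i) *ᵥ κ i = 0 := by
            by_cases hji : j = i
            · rw [hji, hskew]; simp
            · rw [hF j i hji]
              ext a
              have := congrFun (hκ0 i) (j, a)
              simp only [Matrix.mulVec, Matrix.transpose_apply, dotProduct] at this ⊢
              refine Eq.trans ?_ this
              refine Finset.sum_congr rfl fun b _ => ?_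
              congr 1
              have hij : i ≠ j := fun e => hji e.symm
              simp [blockRow, nView, hij, hl j i, hsym i j]
          rw [Matrix.add_mulVec, ← Matrix.mulVec_mulVec, ← Matrix.mulVec_mulVec, hqκ] at h3
          simpa using h3
        ext ⟨j, b⟩
        have := congrFun (h2 j) b
        simp only [Matrix.mulVec, Matrix.transpose_apply, dotProduct, hqR] at this ⊢
        exact this
      obtain ⟨α, hα⟩ := hu' _ h1
      have h4 : Q *ᵥ (Y i *ᵥ κ i) = 0 := by rw [Matrix.mulVec_mulVec, hQY]; simp
      rw [hα, Matrix.mulVec_smul, hQu] at h4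
      rw [hα, h4]
    have hcross1 : ∀ i j, (Y i + vecMulVec u (κ i))ᵀ * q j = (Y i)ᵀ * q j := by
      intro i j
      rw [Matrix.transpose_add, Matrix.add_mul, Matrix.transpose_vecMulVec, Matrix.vecMulVec_mul,
        huq, vecMulVec_zero_right, add_zero]
    have hcross2 : ∀ i j, (q j)ᵀ * (Y i + vecMulVec u (κ i)) = (q j)ᵀ * Y i := by
      intro i j
      rw [Matrix.mul_add, Matrix.mul_vecMulVec, Matrix.mulVec_transpose, huq, vecMulVec_zero_left, add_zero]
    obtain ⟨P, mu, x, y, hcam, hmu, hc, hy, -, -, -, hx⟩ := core n i0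
      (fun i => Y i + vecMulVec u (κ i)) q hq0
      (fun i => by simp only [hcross1, hcross2]; exact hskew i)
      (by
        intro i v h1 h2
        rw [Matrix.add_mulVec, Matrix.vecMulVec_mulVec] at h1
        have h3 : Q *ᵥ (Y i *ᵥ v) = 0 := by rw [Matrix.mulVec_mulVec, hQY]; simp
        have h4 : κ i ⬝ᵥ v = 0 := by
          have := congrArg (fun w => Q *ᵥ w) h1
          simp only [Matrix.mulVec_add, h3, zero_add, Matrix.mulVec_zero] at this
          rw [op_smul_eq_smul, Matrix.mulVec_smul, hQu] at this
          exact (smul_eq_zero.1 this).resolve_right hu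
        have h5 : Y i *ᵥ v = 0 := by simpa [h4] using h1
        obtain ⟨α, rfl⟩ := hκ' i v (hinj i v h5 h2)
        rw [dotProduct_smul] at h4
        have h6 : α = 0 := by
          rcases smul_eq_zero.1 h4 with h | h
          · exact h
          · exact absurd (dot_self_zero h) (hκ i)
        simp [h6])
      F lam hl0
      (fun i j hij => by simp only [hcross1, hcross2]; exact hF i j hij) hrank
    refine ⟨P, mu, hcam, hmu, fun i => ![x i 0, x i 1, x i 2, y i], ?_, ?_⟩
    · intro i
      refine ⟨?_, hc i⟩
      intro h
      have e0 := congrFun h 0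
      have e1 := congrFun h 1
      have e2 := congrFun h 2
      have e3 := congrFun h 3
      simp at e0 e1 e2 e3
      exact hy i (by ext a; fin_cases a <;> simp [*]) e3
    · have hsub : Submodule.span ℝ (Set.range fun i => ![x i 0, x i 1, x i 2, y i]) ≤
          Submodule.span ℝ (Set.range ![![u 0, u 1, u 2, 0], ![0, 0, 0, (1 : ℝ)]]) := by
        rw [Submodule.span_le]
        rintro _ ⟨i, rfl⟩
        obtain ⟨α, hα⟩ := hx i (κ i) (hκ i) (hqκ i)
        rw [Matrix.add_mulVec, hYκ, zero_add, Matrix.vecMulVec_mulVec, op_smul_eq_smul,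
          smul_smul] at hα
        show ![x i 0, x i 1, x i 2, y i] ∈ _
        rw [hα]
        have : (![(α * κ i ⬝ᵥ κ i) * u 0, (α * κ i ⬝ᵥ κ i) * u 1, (α * κ i ⬝ᵥ κ i) * u 2, y i]) =
          (α * κ i ⬝ᵥ κ i) • ![u 0, u 1, u 2, 0] + y i • ![0, 0, 0, (1 : ℝ)] := by
          ext a; fin_cases a <;> simp
        show ![(α * κ i ⬝ᵥ κ i) * u 0, (α * κ i ⬝ᵥ κ i) * u 1, (α * κ i ⬝ᵥ κ i) * u 2, y i] ∈ _
        rw [this]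
        refine Submodule.add_mem _ (Submodule.smul_mem _ _ (Submodule.subset_span ⟨0, rfl⟩))
          (Submodule.smul_mem _ _ (Submodule.subset_span ⟨1, rfl⟩))
      refine (Submodule.finrank_mono hsub).trans ?_
      exact finrank_range_le_card (R := ℝ) ![![u 0, u 1, u 2, 0], ![0, 0, 0, (1 : ℝ)]]
  · rintro - ⟨lam, hl, hl0, hG6, hrow⟩
    have hRinj := ker_of_rank_three (blockRow n (nView n F lam) i0)ᵀ
      (by rw [rank_transpose]; exact hrow i0)
    obtain ⟨Y, q, -, hq0, hqR, hskew, hF, hinj⟩ := setup n i0 F hsym lam hl 0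
      (by simp) (by simp) (by simp)
      (by
        intro y hy
        rw [hRinj y hy]; simp)
      (by rw [hG6, hrow])
    obtain ⟨P, mu, x, y, hcam, hmu, hc, hy, hx0, hx1, hqx, -⟩ := core n i0 Y q hq0 hskew
      (fun i v h1 h2 => ker_of_rank_three (blockRow n (nView n F lam) i)ᵀ
        (by rw [rank_transpose]; exact hrow i) v (hinj i v h1 h2)) F lam hl0 hF hrank
    refine ⟨P, mu, hcam, hmu, fun i => ![x i 0, x i 1, x i 2, y i], ?_, ?_⟩
    · intro i
      refine ⟨?_, hc i⟩
      intro h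
      have e0 := congrFun h 0
      have e1 := congrFun h 1
      have e2 := congrFun h 2
      have e3 := congrFun h 3
      simp at e0 e1 e2 e3
      exact hy i (by ext a; fin_cases a <;> simp [*]) e3
    · by_contra hlt
      rw [not_lt] at hlt
      let i1 : Fin n := ⟨1, by omega⟩
      have hi1 : i1 ≠ i0 := by simp [i1, hi0]
      set c : Fin n → Fin 4 → ℝ := fun i => ![x i 0, x i 1, x i 2, y i] with hcdef
      have hli : LinearIndependent ℝ ![c i0, c i1] := by
        rw [LinearIndependent.pair_iff]
        intro s t hst
        have ht : t • x i1 = 0 := by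
          ext a
          fin_cases a
          · simpa [hcdef, hx0] using congrFun hst 0
          · simpa [hcdef, hx0] using congrFun hst 1
          · simpa [hcdef, hx0] using congrFun hst 2
        have ht0 := (smul_eq_zero.1 ht).resolve_right (hx1 i1 hi1)
        have h3 := congrFun hst 3
        simp [hcdef, ht0] at h3
        exact ⟨h3.resolve_right (hy i0 hx0), ht0⟩
      have hle : Submodule.span ℝ (Set.range ![c i0, c i1]) ≤ Submodule.span ℝ (Set.range c) := by
        apply Submodule.span_mono
        rintro _ ⟨j, rfl⟩
        fin_cases j
        · exact ⟨i0, rfl⟩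
        · exact ⟨i1, rfl⟩
      have heq := Submodule.eq_of_le_of_finrank_le hle (by
        rw [finrank_span_eq_card hli]; simpa using hlt)
      have hall : ∀ i, (q i)ᵀ *ᵥ x i1 = 0 := by
        intro i
        by_cases h : i = i0
        · rw [h, hq0]; simp
        have hmem : c i ∈ Submodule.span ℝ (Set.range ![c i0, c i1]) := by
          rw [heq]; exact Submodule.subset_span ⟨i, rfl⟩
        rw [show Set.range ![c i0, c i1] = {c i0, c i1} by simp [Set.pair_comm],
          Submodule.mem_span_pair] at hmem
        obtain ⟨s, t, hst⟩ := hmem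
        have hxt : x i = t • x i1 := by
          ext a
          fin_cases a
          · simpa [hcdef, hx0] using (congrFun hst 0).symm
          · simpa [hcdef, hx0] using (congrFun hst 1).symm
          · simpa [hcdef, hx0] using (congrFun hst 2).symm
        have ht0 : t ≠ 0 := by
          rintro rfl
          exact hx1 i h (by simpa using hxt)
        have := hqx i
        rw [hxt, Matrix.mulVec_smul] at this
        exact (smul_eq_zero.1 this).resolve_left ht0
      apply hx1 i1 hi1
      apply hRinj
      ext ⟨j, b⟩
      have := congrFun (hall j) b
      simp only [Matrix.mulVec, Matrix.transpose_apply, dotProduct, hqR] at this ⊢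
      exact this
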